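/- Let 0 < T < ∞, ρ ∈ ℂ \ {0}, and let A : [0,T] → M_n(ℂ) have integrable entries. Let U : [0,T] → GL_n(ℂ) be absolutely continuous with everywhere invertible values, and set V(x) = U(x)^{−1}; denote by U_j(x) the j-th column of U(x) and by V_j(x) the j-th row of V(x). Define LY := (1/ρ)Y' − AY for column-vector functions Y and L*Z := (1/ρ)Z' + ZA for row-vector functions Z. Fix γ_1,…,γ_n ∈ [0,T]. Then an absolutely continuous Y : [0,T] → ℂⁿ satisfies LY(x) = 0 almost everywhere on [0,T] if and only if Y satisfies the integral equation Y(x) = Σ_{j=1}^{n} U_j(x)(I_j + ρ∫_{γ_j}^{x} (L*V_j)(t) Y(t) dt) for all x ∈ [0,T], with the constants I_j = V_j(γ_j) Y(γ_j). -/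

import Mathlib

open MeasureTheory Set Finset Matrix

/-- The row vector `(L*V_j)(t)` where `V = U⁻¹`, `L*Z = (1/ρ)Z' + ZA` and
`V' = −V U' V` (valid a.e. for absolutely continuous `U`). -/
noncomputable def LstarRow (n : ℕ) (ρ : ℂ) (A U U' : ℝ → Matrix (Fin n) (Fin n) ℂ)
    (j : Fin n) (t : ℝ) : Fin n → ℂ :=
  fun i => ρ⁻¹ * (-((U t)⁻¹ * U' t * (U t)⁻¹)) j i + ((U t)⁻¹ * A t) j i

namespace AbsolutelyContinuousOnInterval

variable {X X' F : Type*} [PseudoMetricSpace X] [PseudoMetricSpace X']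
  [NormedAddCommGroup F] {a b : ℝ}

theorem of_dist_le {f : ℝ → X} {g : ℝ → X'} {C : ℝ}
    (hg : AbsolutelyContinuousOnInterval g a b)
    (h : ∀ x ∈ uIcc a b, ∀ y ∈ uIcc a b, dist (f x) (f y) ≤ C * dist (g x) (g y)) :
    AbsolutelyContinuousOnInterval f a b := by
  refine squeeze_zero' (.of_forall fun _ => Finset.sum_nonneg fun _ _ => dist_nonneg) ?_
    (by simpa using Filter.Tendsto.const_mul C hg)
  filter_upwards [Filter.mem_inf_of_right (Filter.mem_principal_self _)] with I hI
  rw [Finset.mul_sum]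
  exact Finset.sum_le_sum fun i hi => h _ (hI.1 i hi).1 _ (hI.1 i hi).2

theorem congr {f g : ℝ → X} (hf : AbsolutelyContinuousOnInterval f a b)
    (h : EqOn g f (uIcc a b)) : AbsolutelyContinuousOnInterval g a b :=
  hf.of_dist_le (C := 1) fun x hx y hy => by rw [h hx, h hy, one_mul]

theorem const (c : X) : AbsolutelyContinuousOnInterval (fun _ => c) a b := by
  simpa [AbsolutelyContinuousOnInterval] using tendsto_const_nhds

theorem finset_sum {ι : Type*} (s : Finset ι) {f : ι → ℝ → F}
    (hf : ∀ i ∈ s, AbsolutelyContinuousOnInterval (f i) a b) :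
    AbsolutelyContinuousOnInterval (fun x => ∑ i ∈ s, f i x) a b := by
  classical
  induction s using Finset.induction_on with
  | empty => simpa using const (0 : F)
  | insert i s hi ih =>
    simp only [Finset.sum_insert hi]
    exact (hf i (by simp)).fun_add (ih fun j hj => hf j (by simp [hj]))

theorem complex_mul {f g : ℝ → ℂ} (hf : AbsolutelyContinuousOnInterval f a b)
    (hg : AbsolutelyContinuousOnInterval g a b) :
    AbsolutelyContinuousOnInterval (fun x => f x * g x) a b :=
  hf.fun_smul hg

theorem finset_prod {ι : Type*} (s : Finset ι) {f : ι → ℝ → ℂ}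
    (hf : ∀ i ∈ s, AbsolutelyContinuousOnInterval (f i) a b) :
    AbsolutelyContinuousOnInterval (fun x => ∏ i ∈ s, f i x) a b := by
  classical
  induction s using Finset.induction_on with
  | empty => simpa using const (1 : ℂ)
  | insert i s hi ih =>
    simp only [Finset.prod_insert hi]
    exact (hf i (by simp)).complex_mul (ih fun j hj => hf j (by simp [hj]))

theorem inv₀ {f : ℝ → ℂ} (hf : AbsolutelyContinuousOnInterval f a b)
    (h0 : ∀ x ∈ uIcc a b, f x ≠ 0) :
    AbsolutelyContinuousOnInterval (fun x => (f x)⁻¹) a b := by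
  obtain ⟨C, hC⟩ := isCompact_uIcc.exists_bound_of_continuousOn (hf.continuousOn.inv₀ h0)
  refine hf.of_dist_le (C := C * C) fun x hx y hy => ?_
  have hC0 : 0 ≤ C := (norm_nonneg _).trans (hC x hx)
  rw [dist_eq_norm, dist_eq_norm, inv_sub_inv (h0 x hx) (h0 y hy), div_eq_mul_inv, mul_inv,
    norm_mul, norm_mul, norm_sub_rev, mul_comm]
  gcongr
  exacts [hC x hx, hC y hy]

theorem matrix_det {n : Type*} [Fintype n] [DecidableEq n] {M : ℝ → Matrix n n ℂ}
    (hM : ∀ i j, AbsolutelyContinuousOnInterval (fun x => M x i j) a b) :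
    AbsolutelyContinuousOnInterval (fun x => (M x).det) a b := by
  simp only [Matrix.det_apply']
  exact finset_sum _ fun σ _ => (const ((Equiv.Perm.sign σ : ℤ) : ℂ)).complex_mul (finset_prod _ fun i _ => hM _ _)

theorem matrix_inv {n : Type*} [Fintype n] [DecidableEq n] {M : ℝ → Matrix n n ℂ}
    (hM : ∀ i j, AbsolutelyContinuousOnInterval (fun x => M x i j) a b)
    (hu : ∀ x ∈ uIcc a b, IsUnit (M x)) (i j : n) :
    AbsolutelyContinuousOnInterval (fun x => (M x)⁻¹ i j) a b := by
  simp only [Matrix.inv_def, Ring.inverse_eq_inv', Matrix.smul_apply, smul_eq_mul,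
    Matrix.adjugate_apply]
  have hdet := (matrix_det hM).inv₀ fun x hx =>
    ((Matrix.isUnit_iff_isUnit_det _).1 (hu x hx)).ne_zero
  have hadj : AbsolutelyContinuousOnInterval
      (fun x => ((M x).updateRow j (Pi.single i 1)).det) a b := by
    refine matrix_det fun k l => ?_
    by_cases hk : k = j
    · simp only [hk, Matrix.updateRow_self]
      exact const (Pi.single (M := fun _ => ℂ) i 1 l)
    · simp only [Matrix.updateRow_ne hk]
      exact hM k l
  exact hdet.complex_mul hadj

variable [NormedSpace ℝ F]

theorem integral {f : ℝ → F} {c : ℝ} (hf : IntervalIntegrable f volume a b) (hc : c ∈ uIcc a b) :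
    AbsolutelyContinuousOnInterval (fun x => ∫ t in c..x, f t) a b := by
  refine (hf.norm.absolutelyContinuousOnInterval_intervalIntegral hc).of_dist_le (C := 1)
    fun x hx y hy => ?_
  have hi {z : ℝ} (hz : z ∈ uIcc a b) : IntervalIntegrable f volume c z :=
    hf.mono_set (uIcc_subset_uIcc hc hz)
  rw [dist_eq_norm, one_mul, Real.dist_eq,
    intervalIntegral.integral_interval_sub_left (hi hx) (hi hy),
    intervalIntegral.integral_interval_sub_left (hi hx).norm (hi hy).norm]
  exact intervalIntegral.norm_integral_le_abs_integral_norm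

/-- Fundamental theorem of calculus for absolutely continuous functions with values in a Banach
space, with a prescribed integrable a.e. derivative. -/
theorem integral_eq_sub_of_ae_hasDerivAt [CompleteSpace F] {f f' : ℝ → F}
    (hf : AbsolutelyContinuousOnInterval f a b) (hf' : IntervalIntegrable f' volume a b)
    (hd : ∀ᵐ x, x ∈ uIcc a b → HasDerivAt f (f' x) x) {c d : ℝ} (hc : c ∈ uIcc a b)
    (hdm : d ∈ uIcc a b) : ∫ x in c..d, f' x = f d - f c := by
  obtain ⟨K, hK⟩ := (hf.fun_sub (integral hf' hc)).const_of_ae_hasDerivAt_zero (by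
    filter_upwards [hd, hf'.ae_hasDerivAt_integral] with x h₁ h₂ hx
    simpa using (h₁ hx).fun_sub (h₂ hx c hc))
  have h₁ := hK c hc
  rw [← hK d hdm, intervalIntegral.integral_same, sub_zero] at h₁
  rw [h₁, sub_sub_cancel]

end AbsolutelyContinuousOnInterval

section Primitive

variable {F : Type*} [NormedAddCommGroup F] [NormedSpace ℝ F] {f f' : ℝ → F} {T : ℝ}

theorem absolutelyContinuousOnInterval_of_eq_add_integral (hT : 0 ≤ T)
    (hf' : IntervalIntegrable f' volume 0 T)
    (h : ∀ x ∈ Icc 0 T, f x = f 0 + ∫ t in (0 : ℝ)..x, f' t) :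
    AbsolutelyContinuousOnInterval f 0 T :=
  ((AbsolutelyContinuousOnInterval.const (f 0)).fun_add
    (.integral hf' left_mem_uIcc)).congr (by rwa [uIcc_of_le hT])

variable [CompleteSpace F]

theorem ae_hasDerivAt_of_eq_add_integral
    (hf' : IntervalIntegrable f' volume 0 T)
    (h : ∀ x ∈ Icc 0 T, f x = f 0 + ∫ t in (0 : ℝ)..x, f' t) :
    ∀ᵐ x, x ∈ Ioo 0 T → HasDerivAt f (f' x) x := by
  filter_upwards [hf'.ae_hasDerivAt_integral] with x hx hxI
  have hT : 0 ≤ T := hxI.1.le.trans hxI.2.le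
  refine ((hx (by rw [uIcc_of_le hT]; exact Ioo_subset_Icc_self hxI) 0 left_mem_uIcc).const_add
    (f 0)).congr_of_eventuallyEq ?_
  filter_upwards [Icc_mem_nhds hxI.1 hxI.2] with y hy using h y hy

theorem ae_eq_zero_of_forall_integral_eq_zero {c : ℝ} (hc : c ∈ Icc 0 T)
    (hf' : IntervalIntegrable f' volume 0 T)
    (h : ∀ x ∈ Icc 0 T, ∫ t in c..x, f' t = 0) :
    ∀ᵐ x, x ∈ Ioo 0 T → f' x = 0 := by
  filter_upwards [hf'.ae_hasDerivAt_integral] with x hx hxI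
  have hT : 0 ≤ T := hxI.1.le.trans hxI.2.le
  rw [uIcc_of_le hT] at hx
  refine (hx (Ioo_subset_Icc_self hxI) c hc).unique
    ((hasDerivAt_const x (0 : F)).congr_of_eventuallyEq ?_)
  filter_upwards [Icc_mem_nhds hxI.1 hxI.2] with y hy using h y hy

end Primitive

theorem ae_mem_Icc_iff_ae_mem_Ioo {p : ℝ → Prop} {a b : ℝ} :
    (∀ᵐ x, x ∈ Icc a b → p x) ↔ ∀ᵐ x, x ∈ Ioo a b → p x := by
  rw [← ae_restrict_iff' measurableSet_Icc, ← ae_restrict_iff' measurableSet_Ioo,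
    Measure.restrict_congr_set Ioo_ae_eq_Icc]

section MatrixInverse

attribute [local instance] Matrix.linftyOpNormedRing Matrix.linftyOpNormedAlgebra

theorem hasDerivAt_matrix_inv {n : Type*} [Fintype n] [DecidableEq n]
    {U : ℝ → Matrix n n ℂ} {U' : Matrix n n ℂ} {x : ℝ}
    (hU : ∀ i j, HasDerivAt (fun y => U y i j) (U' i j) x) (hx : IsUnit (U x)) (i j : n) :
    HasDerivAt (fun y => (U y)⁻¹ i j) ((-((U x)⁻¹ * U' * (U x)⁻¹)) i j) x := by
  obtain ⟨u, hu⟩ := hx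
  have hU : HasDerivAt U U' x := hasDerivAt_pi.2 fun i => hasDerivAt_pi.2 (hU i)
  have h := (hu ▸ hasFDerivAt_ringInverse (𝕜 := ℝ) u :
    HasFDerivAt Ring.inverse _ (U x)).comp_hasDerivAt x hU
  have h := hasDerivAt_pi.1 (hasDerivAt_pi.1 h i) j
  simp only [Matrix.nonsing_inv_eq_ringInverse, ← hu, Ring.inverse_unit]
  exact h

end MatrixInverse

/-- For absolutely continuous `Y`, the system `LY = (1/ρ)Y' − AY = 0`
a.e. on `[0,T]` holds iff `Y` satisfies the integral equation (2.8),
`Y(x) = Σ_j U_j(x)(I_j + ρ∫_{γ_j}^x (L*V_j)(t)·Y(t) dt)`, with the constants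
`I_j = V_j(γ_j)·Y(γ_j)`. -/
theorem system_iff_integral_equation (n : ℕ) (T : ℝ) (hT : 0 < T)
    (ρ : ℂ) (hρ : ρ ≠ 0)
    (A : ℝ → Matrix (Fin n) (Fin n) ℂ)
    (hA : ∀ i j, IntervalIntegrable (fun x => A x i j) volume 0 T)
    (U U' : ℝ → Matrix (Fin n) (Fin n) ℂ)
    (hUinv : ∀ x ∈ Set.Icc (0 : ℝ) T, IsUnit (U x))
    (hU'int : ∀ i j, IntervalIntegrable (fun x => U' x i j) volume 0 T)
    (hUac : ∀ i j, ∀ x ∈ Set.Icc (0 : ℝ) T,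
        U x i j = U 0 i j + ∫ t in (0 : ℝ)..x, U' t i j)
    (γ : Fin n → ℝ) (hγ : ∀ j, γ j ∈ Set.Icc (0 : ℝ) T)
    (Y Y' : ℝ → Fin n → ℂ)
    (hY'int : ∀ i, IntervalIntegrable (fun x => Y' x i) volume 0 T)
    (hYac : ∀ i, ∀ x ∈ Set.Icc (0 : ℝ) T, Y x i = Y 0 i + ∫ t in (0 : ℝ)..x, Y' t i) :
    (∀ᵐ x ∂(volume.restrict (Set.Icc (0 : ℝ) T)),
        ρ⁻¹ • Y' x = (A x).mulVec (Y x)) ↔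
    (∀ x ∈ Set.Icc (0 : ℝ) T, ∀ i : Fin n,
        Y x i = ∑ j : Fin n, U x i j *
          ((((U (γ j))⁻¹).mulVec (Y (γ j)) j) +
            ρ * ∫ t in (γ j)..x, ∑ l : Fin n, LstarRow n ρ A U U' j t l * Y t l)) := by
  have hIcc : uIcc 0 T = Icc 0 T := uIcc_of_le hT.le
  have hVac (i j) : AbsolutelyContinuousOnInterval (fun x => (U x)⁻¹ i j) 0 T :=
    .matrix_inv (fun i j => absolutelyContinuousOnInterval_of_eq_add_integral hT.le
      (hU'int i j) (hUac i j)) (hIcc ▸ hUinv) i j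
  have hYac' (i) : AbsolutelyContinuousOnInterval (fun x => Y x i) 0 T :=
    absolutelyContinuousOnInterval_of_eq_add_integral hT.le (hY'int i) (hYac i)
  have hVc (i j) := (hVac i j).continuousOn
  have hYc (i) := (hYac' i).continuousOn
  have sum_int {ι : Type} [Fintype ι] {f : ι → ℝ → ℂ}
      (hf : ∀ i, IntervalIntegrable (f i) volume 0 T) :
      IntervalIntegrable (fun x => ∑ i, f i x) volume 0 T := by
    simpa [Finset.sum_fn] using IntervalIntegrable.sum Finset.univ fun i _ => hf i
  -- `Z = V Y` has a.e. derivative `R + W` with `R = ρ (L*V) Y` and `W = V (Y' - ρ A Y)`.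
  set R : Fin n → ℝ → ℂ := fun j t => ∑ l, LstarRow n ρ A U U' j t l * Y t l with hR
  set W : Fin n → ℝ → ℂ := fun j t => ((U t)⁻¹ *ᵥ (Y' t - ρ • A t *ᵥ Y t)) j with hW
  have hRint (j) : IntervalIntegrable (R j) volume 0 T := by
    refine sum_int fun l => IntervalIntegrable.mul_continuousOn ?_ (hYc l)
    simp only [LstarRow, Matrix.neg_apply, Matrix.mul_apply]
    refine (IntervalIntegrable.const_mul (sum_int fun k => ?_).neg _).add
      (sum_int fun k => (hA k l).continuousOn_mul (hVc j k))
    exact (sum_int fun m => (hU'int m k).continuousOn_mul (hVc j m)).mul_continuousOn (hVc k l)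
  have hWint (j) : IntervalIntegrable (W j) volume 0 T := by
    simp only [hW, Matrix.mulVec, dotProduct, Pi.sub_apply, Pi.smul_apply, smul_eq_mul]
    refine sum_int fun k => IntervalIntegrable.continuousOn_mul ?_ (hVc j k)
    exact (hY'int k).sub ((sum_int fun l => (hA k l).mul_continuousOn (hYc l)).const_mul ρ)
  have hZac (j) : AbsolutelyContinuousOnInterval (fun x => ((U x)⁻¹ *ᵥ Y x) j) 0 T := by
    simp only [Matrix.mulVec, dotProduct]
    exact .finset_sum _ fun k _ => (hVac j k).complex_mul (hYac' k)
  have hZd (j) : ∀ᵐ x, x ∈ uIcc 0 T →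
      HasDerivAt (fun x => ((U x)⁻¹ *ᵥ Y x) j) (ρ * R j x + W j x) x := by
    have hUd := ae_all_iff.2 fun i => ae_all_iff.2 fun k =>
      ae_hasDerivAt_of_eq_add_integral (hU'int i k) (hUac i k)
    have hYd := ae_all_iff.2 fun i => ae_hasDerivAt_of_eq_add_integral (hY'int i) (hYac i)
    rw [hIcc, ae_mem_Icc_iff_ae_mem_Ioo]
    filter_upwards [hUd, hYd] with x hU hY hx
    have hV := hasDerivAt_matrix_inv (fun i k => hU i k hx) (hUinv x (Ioo_subset_Icc_self hx))
    have h := HasDerivAt.fun_sum (u := Finset.univ) fun k _ => (hV j k).fun_mul (hY k hx)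
    refine h.congr_deriv ?_
    have hRx : ρ * R j x =
        (-((U x)⁻¹ * U' x * (U x)⁻¹) *ᵥ Y x + ρ • ((U x)⁻¹ * A x) *ᵥ Y x) j := by
      simp only [hR, LstarRow, Pi.add_apply, Pi.smul_apply, Matrix.mulVec, dotProduct,
        smul_eq_mul, Finset.mul_sum, ← Finset.sum_add_distrib]
      refine Finset.sum_congr rfl fun l _ => ?_
      field_simp
    have hWx : W j x = ((U x)⁻¹ *ᵥ Y' x - ρ • ((U x)⁻¹ * A x) *ᵥ Y x) j := by
      simp only [hW, Matrix.mulVec_sub, Matrix.mulVec_smul, Matrix.mulVec_mulVec]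
    rw [hRx, hWx, Finset.sum_add_distrib]
    simp only [Pi.add_apply, Pi.sub_apply, Matrix.mulVec, dotProduct]
    ring
  have hftc (j) {x} (hx : x ∈ Icc 0 T) :
      ((U x)⁻¹ *ᵥ Y x) j =
        ((U (γ j))⁻¹ *ᵥ Y (γ j)) j + ρ * (∫ t in γ j..x, R j t) + ∫ t in γ j..x, W j t := by
    have hs : uIcc (γ j) x ⊆ uIcc 0 T := uIcc_subset_uIcc (hIcc ▸ hγ j) (hIcc ▸ hx)
    have h := (hZac j).integral_eq_sub_of_ae_hasDerivAt (((hRint j).const_mul ρ).add (hWint j))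
      (hZd j) (hIcc ▸ hγ j) (hIcc ▸ hx)
    rw [intervalIntegral.integral_add (((hRint j).const_mul ρ).mono_set hs)
      ((hWint j).mono_set hs), intervalIntegral.integral_const_mul] at h
    linear_combination -h
  have hode {x} (hx : x ∈ Icc 0 T) : ρ⁻¹ • Y' x = A x *ᵥ Y x ↔ ∀ j, W j x = 0 := by
    have hdet := (Matrix.isUnit_iff_isUnit_det _).1 (hUinv x hx)
    rw [inv_smul_eq_iff₀ hρ, ← sub_eq_zero]
    constructor
    · intro h j
      simp [hW, h]
    · intro h
      have h : (U x)⁻¹ *ᵥ (Y' x - ρ • A x *ᵥ Y x) = 0 := funext h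
      simpa [Matrix.mulVec_mulVec, Matrix.mul_nonsing_inv _ hdet] using congrArg (U x *ᵥ ·) h
  have hint {x} (hx : x ∈ Icc 0 T) :
      (∀ i, Y x i = ∑ j, U x i j *
        (((U (γ j))⁻¹ *ᵥ Y (γ j)) j + ρ * ∫ t in γ j..x, R j t)) ↔
      ∀ j, ∫ t in γ j..x, W j t = 0 := by
    have hdet := (Matrix.isUnit_iff_isUnit_det _).1 (hUinv x hx)
    have h₁ : Y x = U x *ᵥ ((U x)⁻¹ *ᵥ Y x) := by
      simp [Matrix.mulVec_mulVec, Matrix.mul_nonsing_inv _ hdet]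
    set w : Fin n → ℂ := fun j => ((U (γ j))⁻¹ *ᵥ Y (γ j)) j + ρ * ∫ t in γ j..x, R j t
    have hw : (U x)⁻¹ *ᵥ Y x = w ↔ ∀ j, ∫ t in γ j..x, W j t = 0 := by
      rw [funext_iff]
      refine forall_congr' fun j => ?_
      rw [hftc j hx, add_eq_left]
    rw [← hw]
    change (∀ i, Y x i = (U x *ᵥ w) i) ↔ _
    rw [← funext_iff]
    constructor
    · intro h
      rw [h, Matrix.mulVec_mulVec, Matrix.nonsing_inv_mul _ hdet, Matrix.one_mulVec]
    · intro h
      rwa [h] at h₁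
  rw [ae_restrict_iff' measurableSet_Icc]
  trans ∀ x ∈ Icc 0 T, ∀ j, ∫ t in γ j..x, W j t = 0
  · constructor
    · intro h x hx j
      refine intervalIntegral.integral_zero_ae ?_
      filter_upwards [h] with t ht htI
      have htI : t ∈ Icc 0 T :=
        uIcc_subset_Icc (hγ j) hx (uIoc_subset_uIcc htI)
      exact (hode htI).1 (ht htI) j
    · intro h
      rw [ae_mem_Icc_iff_ae_mem_Ioo]
      have := ae_all_iff.2 fun j =>
        ae_eq_zero_of_forall_integral_eq_zero (hγ j) (hWint j) fun x hx => h x hx j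
      filter_upwards [this] with x hx hxI
      exact (hode (Ioo_subset_Icc_self hxI)).2 fun j => hx j hxI
  · exact forall₂_congr fun x hx => (hint hx).symm
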